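/- No plane curve of degree 5 can have 7 singular points in general position (no 3 on a line, no 6 on a conic, no 10 on a cubic). -/

import Mathlib

/-- `f` is singular at the point of `ℂP²` represented by the nonzero vector `v`:
all partial derivatives vanish at `v`. -/
def SingularAt (f : MvPolynomial (Fin 3) ℂ) (v : Fin 3 → ℂ) : Prop :=
  ∀ j : Fin 3, MvPolynomial.eval v (MvPolynomial.pderiv j f) = 0

/-- A function on `ℂ³` given by a homogeneous polynomial of degree `n`. -/
def IsForm (n : ℕ) (F : (Fin 3 → ℂ) → ℂ) : Prop :=
  ∃ f : MvPolynomial (Fin 3) ℂ, f.IsHomogeneous n ∧ F = fun x => MvPolynomial.eval x f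

/-- `F` vanishes at `v` together with its derivative. -/
def IsDoublePoint (F : (Fin 3 → ℂ) → ℂ) (v : Fin 3 → ℂ) : Prop :=
  F v = 0 ∧ HasFDerivAt F (0 : (Fin 3 → ℂ) →L[ℂ] ℂ) v

theorem hasFDerivAt_eval_mvPolynomial (f : MvPolynomial (Fin 3) ℂ) (x : Fin 3 → ℂ) :
    HasFDerivAt (fun y => MvPolynomial.eval y f)
      (∑ j, MvPolynomial.eval x (MvPolynomial.pderiv j f) •
        ContinuousLinearMap.proj (R := ℂ) (φ := fun _ : Fin 3 => ℂ) j) x := by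
  induction f using MvPolynomial.induction_on with
  | C a =>
    exact (hasFDerivAt_const a x).congr_fderiv (by ext w; simp) |>.congr_of_eventuallyEq
      (.of_forall fun y => by simp)
  | add p q hp hq =>
    exact (hp.add hq).congr_fderiv (by ext w; simp [add_mul, Finset.sum_add_distrib])
      |>.congr_of_eventuallyEq (.of_forall fun y => by simp)
  | mul_X p i hp =>
    have h := hp.mul (ContinuousLinearMap.proj (R := ℂ) (φ := fun _ : Fin 3 => ℂ) i).hasFDerivAt
    refine (h.congr_fderiv ?_).congr_of_eventuallyEq (.of_forall fun y => by simp)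
    ext w
    simp [MvPolynomial.pderiv_X, Pi.single_apply, add_mul, Finset.sum_add_distrib,
      Finset.mul_sum, apply_ite]
    fin_cases i <;> simp [Fin.sum_univ_three] <;> ring

theorem MvPolynomial.IsHomogeneous.sum_fin_three_eq {f : MvPolynomial (Fin 3) ℂ} {n : ℕ}
    (hf : f.IsHomogeneous n) {d : Fin 3 →₀ ℕ} (hd : d ∈ f.support) : d 0 + d 1 + d 2 = n := by
  rw [hf.degree_eq_sum_deg_support hd, Finset.sum_subset (Finset.subset_univ _) (by simp),
    Fin.sum_univ_three]

namespace IsForm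

variable {n : ℕ} {F G : (Fin 3 → ℂ) → ℂ}

theorem add (hF : IsForm n F) (hG : IsForm n G) : IsForm n (fun x => F x + G x) := by
  obtain ⟨f, hf, rfl⟩ := hF
  obtain ⟨g, hg, rfl⟩ := hG
  exact ⟨f + g, hf.add hg, by simp⟩

theorem monomial (c : ℂ) (i j k : ℕ) :
    IsForm (i + j + k) (fun x => c * x 0 ^ i * x 1 ^ j * x 2 ^ k) := by
  refine ⟨MvPolynomial.C c * MvPolynomial.X 0 ^ i * MvPolynomial.X 1 ^ j * MvPolynomial.X 2 ^ k,
    ?_, by simp⟩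
  refine MvPolynomial.IsHomogeneous.mul (.mul ?_ (MvPolynomial.isHomogeneous_X_pow _ _))
    (MvPolynomial.isHomogeneous_X_pow _ _)
  simpa using (MvPolynomial.isHomogeneous_X_pow (R := ℂ) (0 : Fin 3) i).C_mul c

theorem comp_vecMul (hF : IsForm n F) (M : Matrix (Fin 3) (Fin 3) ℂ) :
    IsForm n (fun x => F (Matrix.vecMul x M)) := by
  obtain ⟨f, hf, rfl⟩ := hF
  refine ⟨MvPolynomial.aeval
    (fun j => ∑ i, MvPolynomial.C (M i j) * MvPolynomial.X i) f, ?_, ?_⟩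
  · have := hf.aeval (fun j => ∑ i, MvPolynomial.C (M i j) * MvPolynomial.X i) (n := 1)
      (fun j => MvPolynomial.IsHomogeneous.sum _ _ _
        fun i _ => MvPolynomial.isHomogeneous_C_mul_X _ _)
    simpa using this
  · clear hf
    funext x
    induction f using MvPolynomial.induction_on <;>
      simp_all [Matrix.vecMul, dotProduct, mul_comm]

theorem map_smul (hF : IsForm n F) (t : ℂ) (x : Fin 3 → ℂ) : F (t • x) = t ^ n * F x := by
  obtain ⟨f, hf, rfl⟩ := hF
  have h : ∀ d ∈ f.support, d 0 + d 1 + d 2 = n := fun _ => hf.sum_fin_three_eq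
  simp only [MvPolynomial.eval_eq', Finset.mul_sum, Fin.prod_univ_three, Pi.smul_apply,
    smul_eq_mul]
  refine Finset.sum_congr rfl fun d hd => ?_
  rw [← h d hd]
  ring

theorem exists_coeff (hF : IsForm n F) : ∃ c : ℕ → ℕ → ℂ, ∀ x y z : ℂ,
    F ![x, y, z] = ∑ i ∈ Finset.range (n + 1), ∑ j ∈ Finset.range (n + 1 - i),
      c i j * x ^ i * y ^ j * z ^ (n - i - j) := by
  obtain ⟨f, hf, rfl⟩ := hF
  have h : ∀ d ∈ f.support, d 0 + d 1 + d 2 = n := fun _ => hf.sum_fin_three_eq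
  let e : ℕ → ℕ → (Fin 3 →₀ ℕ) := fun i j => Finsupp.equivFunOnFinite.symm ![i, j, n - i - j]
  have he : ∀ d ∈ f.support, e (d 0) (d 1) = d := fun d hd => by
    have := h d hd
    ext k
    fin_cases k <;> simp [e]
    omega
  refine ⟨fun i j => f.coeff (e i j), fun x y z => ?_⟩
  simp only [Finset.sum_sigma', MvPolynomial.eval_eq']
  refine Finset.sum_of_injOn (fun d => ⟨d 0, d 1⟩) ?_ ?_ ?_ ?_
  · intro d hd d' hd' hdd
    simp only [Sigma.mk.injEq, heq_eq_eq] at hdd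
    rw [← he d hd, ← he d' hd', hdd.1, hdd.2]
  · intro d hd
    have := h d hd
    simp
    omega
  · rintro ⟨i, j⟩ _ hij
    by_cases hc : f.coeff (e i j) = 0
    · simp [hc]
    · exact absurd ⟨e i j, by simpa using hc, by simp [e]⟩ hij
  · intro d hd
    have := h d hd
    simp only [he d hd, Fin.prod_univ_three]
    rw [show n - d 0 - d 1 = d 2 by omega]
    simp [mul_assoc]

end IsForm

namespace IsDoublePoint

variable {n : ℕ} {F : (Fin 3 → ℂ) → ℂ} {v : Fin 3 → ℂ}

theorem of_singularAt {f : MvPolynomial (Fin 3) ℂ} (hf : f.IsHomogeneous n) (hn : n ≠ 0)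
    (h : SingularAt f v) : IsDoublePoint (fun x => MvPolynomial.eval x f) v := by
  constructor
  · have := congrArg (MvPolynomial.eval v) hf.sum_X_mul_pderiv
    simpa [h _, hn, eq_comm (a := (0 : ℂ))] using this
  · exact (hasFDerivAt_eval_mvPolynomial f v).congr_fderiv (by ext w; simp [h _])

theorem comp_vecMul {M : Matrix (Fin 3) (Fin 3) ℂ}
    (h : IsDoublePoint F (Matrix.vecMul v M)) :
    IsDoublePoint (fun x => F (Matrix.vecMul x M)) v := by
  refine ⟨h.1, ?_⟩
  have h₂ := h.2
  have hM : HasFDerivAt (fun x : Fin 3 → ℂ => Matrix.vecMul x M)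
      (LinearMap.toContinuousLinearMap M.vecMulLinear) v :=
    (LinearMap.toContinuousLinearMap M.vecMulLinear).hasFDerivAt
  exact (HasFDerivAt.comp v h₂ hM).congr_fderiv (by simp)

theorem smul (hF : IsForm n F) (h : IsDoublePoint F v) {t : ℂ} (ht : t ≠ 0) :
    IsDoublePoint F (t • v) := by
  refine ⟨by rw [hF.map_smul, h.1, mul_zero], ?_⟩
  have hs : HasFDerivAt (fun x : Fin 3 → ℂ => t⁻¹ • x)
      (t⁻¹ • ContinuousLinearMap.id ℂ (Fin 3 → ℂ)) (t • v) :=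
    (t⁻¹ • ContinuousLinearMap.id ℂ (Fin 3 → ℂ)).hasFDerivAt
  have h₂ : HasFDerivAt F (0 : (Fin 3 → ℂ) →L[ℂ] ℂ) (t⁻¹ • t • v) := by
    rw [inv_smul_smul₀ ht]; exact h.2
  have h₃ := (HasFDerivAt.comp (t • v) h₂ hs).const_mul (t ^ n)
  refine (h₃.congr_of_eventuallyEq (.of_forall fun x => ?_)).congr_fderiv (by ext w; simp)
  simp only [Function.comp]
  rw [hF.map_smul, inv_pow, mul_inv_cancel_left₀ (pow_ne_zero _ ht)]

/-- Restricting to a line through a double point kills the two lowest coefficients. -/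
theorem coeff_eq_zero (h : IsDoublePoint F v) (w : Fin 3 → ℂ) {c₀ c₁ c₂ c₃ c₄ c₅ : ℂ}
    (hc : ∀ t : ℂ, F (v + t • w) =
      c₀ + c₁ * t + c₂ * t ^ 2 + c₃ * t ^ 3 + c₄ * t ^ 4 + c₅ * t ^ 5) :
    c₀ = 0 ∧ c₁ = 0 := by
  constructor
  · simpa [h.1] using (hc 0).symm
  · have hl : HasDerivAt (fun t : ℂ => v + t • w) w 0 := by
      simpa using ((hasDerivAt_id (0 : ℂ)).smul_const w).const_add v
    have h₂ : HasFDerivAt F (0 : (Fin 3 → ℂ) →L[ℂ] ℂ) (v + (0 : ℂ) • w) := by simpa using h.2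
    have h₃ := h₂.comp_hasDerivAt (0 : ℂ) hl
    have h₄ : HasDerivAt (fun t : ℂ =>
        c₀ + c₁ * t + c₂ * t ^ 2 + c₃ * t ^ 3 + c₄ * t ^ 4 + c₅ * t ^ 5) c₁ 0 := by
      have hp := fun (c : ℂ) (k : ℕ) => (hasDerivAt_pow k (0 : ℂ)).const_mul c
      have := ((((((hasDerivAt_const (0 : ℂ) c₀).add ((hasDerivAt_id (0 : ℂ)).const_mul c₁)).add
        (hp c₂ 2)).add (hp c₃ 3)).add (hp c₄ 4)).add (hp c₅ 5))
      refine (this.congr_deriv (by simp)).congr_of_eventuallyEq (.of_forall fun t => by simp)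
    have h₅ : (F ∘ fun t : ℂ => v + t • w) = _ := funext hc
    rw [h₅] at h₃
    simpa using h₄.unique h₃

end IsDoublePoint

/-- Three zeros of a nonzero binary quadratic form include two proportional ones. -/
theorem exists_linear_of_binary_quadratic {a b k : ℂ} (hne : ¬ (a = 0 ∧ b = 0 ∧ k = 0))
    (X Y : Fin 3 → ℂ) (h : ∀ i, a * X i ^ 2 + k * X i * Y i + b * Y i ^ 2 = 0) :
    ∃ α β : ℂ, ¬ (α = 0 ∧ β = 0) ∧ ∃ m, ∀ i, i ≠ m → α * X i + β * Y i = 0 := by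
  have pair : ∀ i j, X i * Y j - X j * Y i = 0 →
      ∃ α β : ℂ, ¬ (α = 0 ∧ β = 0) ∧ α * X i + β * Y i = 0 ∧ α * X j + β * Y j = 0 := by
    intro i j hij
    by_cases hi : X i = 0 ∧ Y i = 0
    · by_cases hj : X j = 0 ∧ Y j = 0
      · exact ⟨1, 0, by simp, by simp [hi], by simp [hj]⟩
      · refine ⟨Y j, -X j, fun h => hj ⟨by simpa using h.2, h.1⟩, by simp [hi], by ring⟩
    · refine ⟨Y i, -X i, fun h => hi ⟨by simpa using h.2, h.1⟩, by ring, ?_⟩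
      linear_combination -hij
  have key : (X 0 * Y 1 - X 1 * Y 0) * (X 0 * Y 2 - X 2 * Y 0) * (X 1 * Y 2 - X 2 * Y 1) = 0 := by
    by_contra hD
    have h0 := h 0
    have h1 := h 1
    have h2 := h 2
    refine hne ⟨(mul_eq_zero.1 ?_).resolve_left hD, (mul_eq_zero.1 ?_).resolve_left hD,
      (mul_eq_zero.1 ?_).resolve_left hD⟩
    · linear_combination (Y 1 * Y 2 * (X 1 * Y 2 - X 2 * Y 1)) * h0
        - (Y 0 * Y 2 * (X 0 * Y 2 - X 2 * Y 0)) * h1 + (Y 0 * Y 1 * (X 0 * Y 1 - X 1 * Y 0)) * h2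
    · linear_combination (X 1 * X 2 * (X 1 * Y 2 - X 2 * Y 1)) * h0
        - (X 0 * X 2 * (X 0 * Y 2 - X 2 * Y 0)) * h1 + (X 0 * X 1 * (X 0 * Y 1 - X 1 * Y 0)) * h2
    · linear_combination (-(X 1 ^ 2 * Y 2 ^ 2 - X 2 ^ 2 * Y 1 ^ 2)) * h0
        + (X 0 ^ 2 * Y 2 ^ 2 - X 2 ^ 2 * Y 0 ^ 2) * h1 - (X 0 ^ 2 * Y 1 ^ 2 - X 1 ^ 2 * Y 0 ^ 2) * h2
  rcases mul_eq_zero.1 key with hk | hk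
  · rcases mul_eq_zero.1 hk with hk | hk
    · obtain ⟨α, β, hαβ, h₁, h₂⟩ := pair 0 1 hk
      exact ⟨α, β, hαβ, 2, fun i hi => by fin_cases i <;> simp_all⟩
    · obtain ⟨α, β, hαβ, h₁, h₂⟩ := pair 0 2 hk
      exact ⟨α, β, hαβ, 1, fun i hi => by fin_cases i <;> simp_all⟩
  · obtain ⟨α, β, hαβ, h₁, h₂⟩ := pair 1 2 hk
    exact ⟨α, β, hαβ, 0, fun i hi => by fin_cases i <;> simp_all⟩

/-- A quartic with double points at the coordinate points and at `(1, 1, 1)` is a quadratic form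
in the two conics spanning the pencil through these four points. -/
theorem quartic_eq_of_isDoublePoint {H : (Fin 3 → ℂ) → ℂ} (hH : IsForm 4 H)
    (h₀ : IsDoublePoint H ![1, 0, 0]) (h₁ : IsDoublePoint H ![0, 1, 0])
    (h₂ : IsDoublePoint H ![0, 0, 1]) (h₃ : IsDoublePoint H ![1, 1, 1]) :
    ∃ a b k : ℂ, ∀ x y z : ℂ, H ![x, y, z] = a * (y * z - x * y) ^ 2
      + k * (y * z - x * y) * (x * z - x * y) + b * (x * z - x * y) ^ 2 := by
  obtain ⟨c, hc⟩ := hH.exists_coeff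
  simp only [Finset.sum_range_succ, Finset.sum_range_zero, Nat.reduceAdd, Nat.reduceSub,
    zero_add, pow_zero, mul_one, pow_one] at hc
  have e₀ := h₀.coeff_eq_zero ![0, 1, 0] (c₀ := c 4 0) (c₁ := c 3 1) (c₂ := c 2 2) (c₃ := c 1 3)
    (c₄ := c 0 4) (c₅ := 0) (fun t => by simp [hc]; ring)
  have e₀' := h₀.coeff_eq_zero ![0, 0, 1] (c₀ := c 4 0) (c₁ := c 3 0) (c₂ := c 2 0) (c₃ := c 1 0)
    (c₄ := c 0 0) (c₅ := 0) (fun t => by simp [hc]; ring)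
  have e₁ := h₁.coeff_eq_zero ![1, 0, 0] (c₀ := c 0 4) (c₁ := c 1 3) (c₂ := c 2 2) (c₃ := c 3 1)
    (c₄ := c 4 0) (c₅ := 0) (fun t => by simp [hc])
  have e₁' := h₁.coeff_eq_zero ![0, 0, 1] (c₀ := c 0 4) (c₁ := c 0 3) (c₂ := c 0 2) (c₃ := c 0 1)
    (c₄ := c 0 0) (c₅ := 0) (fun t => by simp [hc]; ring)
  have e₂ := h₂.coeff_eq_zero ![1, 0, 0] (c₀ := c 0 0) (c₁ := c 1 0) (c₂ := c 2 0) (c₃ := c 3 0)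
    (c₄ := c 4 0) (c₅ := 0) (fun t => by simp [hc])
  have e₂' := h₂.coeff_eq_zero ![0, 1, 0] (c₀ := c 0 0) (c₁ := c 0 1) (c₂ := c 0 2) (c₃ := c 0 3)
    (c₄ := c 0 4) (c₅ := 0) (fun t => by simp [hc])
  simp only [e₀, e₀', e₁, e₁', e₂, e₂', zero_mul, add_zero, zero_add] at hc
  have f₀ := h₃.coeff_eq_zero ![1, 0, 0]
    (c₀ := c 0 2 + c 1 1 + c 1 2 + c 2 0 + c 2 1 + c 2 2)
    (c₁ := c 1 1 + c 1 2 + 2 * (c 2 0 + c 2 1 + c 2 2)) (c₂ := c 2 0 + c 2 1 + c 2 2)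
    (c₃ := 0) (c₄ := 0) (c₅ := 0) (fun t => by simp [hc]; ring)
  have f₁ := h₃.coeff_eq_zero ![0, 1, 0]
    (c₀ := c 0 2 + c 1 1 + c 1 2 + c 2 0 + c 2 1 + c 2 2)
    (c₁ := c 1 1 + c 2 1 + 2 * (c 0 2 + c 1 2 + c 2 2)) (c₂ := c 0 2 + c 1 2 + c 2 2)
    (c₃ := 0) (c₄ := 0) (c₅ := 0) (fun t => by simp [hc]; ring)
  have f₂ := h₃.coeff_eq_zero ![0, 0, 1]
    (c₀ := c 0 2 + c 1 1 + c 1 2 + c 2 0 + c 2 1 + c 2 2)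
    (c₁ := c 1 2 + c 2 1 + 2 * (c 0 2 + c 1 1 + c 2 0)) (c₂ := c 0 2 + c 1 1 + c 2 0)
    (c₃ := 0) (c₄ := 0) (c₅ := 0) (fun t => by simp [hc]; ring)
  obtain ⟨-, f₀⟩ := f₀
  obtain ⟨-, f₁⟩ := f₁
  obtain ⟨-, f₂⟩ := f₂
  have g₀ : c 1 2 = -2 * c 0 2 - c 1 1 := by linear_combination (f₁ + f₂ - f₀) / 2
  have g₁ : c 2 1 = -2 * c 2 0 - c 1 1 := by linear_combination (f₀ + f₂ - f₁) / 2
  have g₂ : c 2 2 = c 0 2 + c 2 0 + c 1 1 := by linear_combination (f₀ + f₁ - f₂) / 4 - g₀ / 2 - g₁ / 2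
  refine ⟨c 0 2, c 2 0, c 1 1, fun x y z => ?_⟩
  rw [hc, g₀, g₁, g₂]
  ring

/-- A coordinate change moving four points, no three collinear, to the standard frame. -/
theorem exists_frame (p : Fin 4 → Fin 3 → ℂ)
    (hp : ∀ i j k, i ≠ j → i ≠ k → j ≠ k → (Matrix.of ![p i, p j, p k]).det ≠ 0) :
    ∃ t : Fin 3 → ℂ, (∀ i, t i ≠ 0) ∧
      (Matrix.of ![t 0 • p 0, t 1 • p 1, t 2 • p 2]).det ≠ 0 ∧
      t 0 • p 0 + t 1 • p 1 + t 2 • p 2 = p 3 := by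
  have hA := hp 0 1 2 (by decide) (by decide) (by decide)
  obtain ⟨t, ht⟩ : ∃ t : Fin 3 → ℂ, Matrix.vecMul t (.of ![p 0, p 1, p 2]) = p 3 :=
    ⟨Matrix.vecMul (p 3) (.of ![p 0, p 1, p 2])⁻¹, by
      rw [Matrix.vecMul_vecMul, Matrix.nonsing_inv_mul _ (isUnit_iff_ne_zero.2 hA),
        Matrix.vecMul_one]⟩
  have hsum : t 0 • p 0 + t 1 • p 1 + t 2 • p 2 = p 3 := by
    rw [← ht]
    ext j
    simp [Matrix.vecMul, dotProduct, Fin.sum_univ_three]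
  have hd : ∀ i, t i ≠ 0 := by
    have h0 := hp 1 2 3 (by decide) (by decide) (by decide)
    have h1 := hp 0 2 3 (by decide) (by decide) (by decide)
    have h2 := hp 0 1 3 (by decide) (by decide) (by decide)
    rw [← hsum] at h0 h1 h2
    intro i hi
    fin_cases i <;> simp only [Fin.zero_eta, Fin.mk_one, Fin.reduceFinMk] at hi
    · refine h0 ?_
      simp [hi, Matrix.det_fin_three]
      ring
    · refine h1 ?_
      simp [hi, Matrix.det_fin_three]
      ring
    · refine h2 ?_
      simp [hi, Matrix.det_fin_three]
      ring
  refine ⟨t, hd, ?_, hsum⟩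
  have : (Matrix.of ![t 0 • p 0, t 1 • p 1, t 2 • p 2]).det =
      t 0 * t 1 * t 2 * (Matrix.of ![p 0, p 1, p 2]).det := by
    simp [Matrix.det_fin_three]
    ring
  rw [this]
  exact mul_ne_zero (mul_ne_zero (mul_ne_zero (hd 0) (hd 1)) (hd 2)) hA

/-- The zeros of a nonzero quartic with four double points, no three collinear, lie two by two
on conics through these points. -/
theorem exists_conic_of_quartic {G : (Fin 3 → ℂ) → ℂ} (hG : IsForm 4 G) (hG₀ : G ≠ 0)
    (p : Fin 4 → Fin 3 → ℂ)
    (hp : ∀ i j k, i ≠ j → i ≠ k → j ≠ k → (Matrix.of ![p i, p j, p k]).det ≠ 0)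
    (hs : ∀ i, IsDoublePoint G (p i)) (b : Fin 3 → Fin 3 → ℂ) (hb : ∀ i, G (b i) = 0) :
    ∃ Q, IsForm 2 Q ∧ Q ≠ 0 ∧ (∀ i, Q (p i) = 0) ∧ ∃ m, ∀ i, i ≠ m → Q (b i) = 0 := by
  obtain ⟨t, ht, hM, hsum⟩ := exists_frame p hp
  let r : Fin 3 → Fin 3 → ℂ := ![t 0 • p 0, t 1 • p 1, t 2 • p 2]
  let M : Matrix (Fin 3) (Fin 3) ℂ := .of r
  have hMu : IsUnit M.det := isUnit_iff_ne_zero.2 hM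
  have hMM : ∀ x, Matrix.vecMul (Matrix.vecMul x M) M⁻¹ = x := fun x => by
    rw [Matrix.vecMul_vecMul, Matrix.mul_nonsing_inv _ hMu, Matrix.vecMul_one]
  have hMM' : ∀ x, Matrix.vecMul (Matrix.vecMul x M⁻¹) M = x := fun x => by
    rw [Matrix.vecMul_vecMul, Matrix.nonsing_inv_mul _ hMu, Matrix.vecMul_one]
  have m₀ : Matrix.vecMul ![1, 0, 0] M = t 0 • p 0 := by simp [M, r]
  have m₁ : Matrix.vecMul ![0, 1, 0] M = t 1 • p 1 := by simp [M, r]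
  have m₂ : Matrix.vecMul ![0, 0, 1] M = t 2 • p 2 := by simp [M, r]
  have m₃ : Matrix.vecMul ![1, 1, 1] M = p 3 := by
    rw [← hsum]; simp [M, r, add_assoc]
  obtain ⟨a, β, k, hH⟩ := quartic_eq_of_isDoublePoint (hG.comp_vecMul M)
    (.comp_vecMul (by rw [m₀]; exact (hs 0).smul hG (ht 0)))
    (.comp_vecMul (by rw [m₁]; exact (hs 1).smul hG (ht 1)))
    (.comp_vecMul (by rw [m₂]; exact (hs 2).smul hG (ht 2)))
    (.comp_vecMul (by rw [m₃]; exact hs 3))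
  have hcoord : ∀ x : Fin 3 → ℂ, x = ![x 0, x 1, x 2] := fun x => by
    ext i; fin_cases i <;> rfl
  let y : Fin 3 → Fin 3 → ℂ := fun i => Matrix.vecMul (b i) M⁻¹
  have hy : ∀ i, Matrix.vecMul ![y i 0, y i 1, y i 2] M = b i := fun i => by
    rw [← hcoord]; exact hMM' _
  obtain ⟨α, γ, hαγ, m, hm⟩ := exists_linear_of_binary_quadratic (a := a) (b := β) (k := k)
    (by
      rintro ⟨rfl, rfl, rfl⟩
      refine hG₀ (funext fun x => ?_)
      have := hH (Matrix.vecMul x M⁻¹ 0) (Matrix.vecMul x M⁻¹ 1) (Matrix.vecMul x M⁻¹ 2)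
      rw [← hcoord, hMM'] at this
      simpa using this)
    (fun i => y i 1 * y i 2 - y i 0 * y i 1) (fun i => y i 0 * y i 2 - y i 0 * y i 1)
    (fun i => by rw [← hH, hy, hb])
  let q : (Fin 3 → ℂ) → ℂ := fun x => α * (x 1 * x 2 - x 0 * x 1) + γ * (x 0 * x 2 - x 0 * x 1)
  have hq : IsForm 2 q := by
    convert ((IsForm.monomial α 0 1 1).add (IsForm.monomial γ 1 0 1)).add
      (IsForm.monomial (-α - γ) 1 1 0) using 1
    ext x
    simp only [q]
    ring
  refine ⟨fun x => q (Matrix.vecMul x M⁻¹), hq.comp_vecMul _, fun h0 => hαγ ?_, ?_, m,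
    fun i hi => hm i hi⟩
  · have h0' : ∀ x, q x = 0 := fun x => by
      have := congrFun h0 (Matrix.vecMul x M)
      simpa [hMM] using this
    exact ⟨by simpa [q] using h0' ![0, 1, 1], by simpa [q] using h0' ![1, 0, 1]⟩
  · have hz : ∀ (i : Fin 4) (s : ℂ) (x : Fin 3 → ℂ), s ≠ 0 → Matrix.vecMul x M = s • p i →
        q x = 0 → q (Matrix.vecMul (p i) M⁻¹) = 0 := by
      intro i s x hs' hx hqx
      have : Matrix.vecMul (p i) M⁻¹ = s⁻¹ • x := by
        rw [← hMM x, hx, ← Matrix.smul_vecMul, inv_smul_smul₀ hs']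
      rw [this, hq.map_smul, hqx, mul_zero]
    intro i
    fin_cases i
    · exact hz 0 _ _ (ht 0) m₀ (by simp [q])
    · exact hz 1 _ _ (ht 1) m₁ (by simp [q])
    · exact hz 2 _ _ (ht 2) m₂ (by simp [q])
    · exact hz 3 1 _ one_ne_zero (by rw [m₃, one_smul]) (by simp [q])

/-- The standard quadratic transformation of the projective plane. -/
def cremona (x : Fin 3 → ℂ) : Fin 3 → ℂ := ![x 1 * x 2, x 0 * x 2, x 0 * x 1]

theorem cremona_cremona (x : Fin 3 → ℂ) : cremona (cremona x) = (x 0 * x 1 * x 2) • x := by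
  ext i
  fin_cases i <;> simp [cremona] <;> ring

theorem differentiable_cremona : Differentiable ℂ cremona := by
  rw [differentiable_pi]
  intro i
  fin_cases i <;> simp [cremona] <;> fun_prop

/-- A quintic with double points at the coordinate points is transformed into a quartic through
the coordinate points. -/
theorem exists_quartic_cremona {F : (Fin 3 → ℂ) → ℂ} (hF : IsForm 5 F)
    (h₀ : IsDoublePoint F ![1, 0, 0]) (h₁ : IsDoublePoint F ![0, 1, 0])
    (h₂ : IsDoublePoint F ![0, 0, 1]) :
    ∃ G, IsForm 4 G ∧ G ![1, 0, 0] = 0 ∧ G ![0, 1, 0] = 0 ∧ G ![0, 0, 1] = 0 ∧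
      (∀ x, F (cremona x) = (x 0 * x 1 * x 2) ^ 2 * G x) ∧
      ∀ x, G (cremona x) = x 0 * x 1 * x 2 * F x := by
  obtain ⟨c, hc⟩ := hF.exists_coeff
  simp only [Finset.sum_range_succ, Finset.sum_range_zero, Nat.reduceAdd, Nat.reduceSub,
    zero_add, pow_zero, mul_one, pow_one] at hc
  have e₀ := h₀.coeff_eq_zero ![0, 1, 0] (c₀ := c 5 0) (c₁ := c 4 1) (c₂ := c 3 2) (c₃ := c 2 3)
    (c₄ := c 1 4) (c₅ := c 0 5) (fun t => by simp [hc]; ring)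
  have e₀' := h₀.coeff_eq_zero ![0, 0, 1] (c₀ := c 5 0) (c₁ := c 4 0) (c₂ := c 3 0) (c₃ := c 2 0)
    (c₄ := c 1 0) (c₅ := c 0 0) (fun t => by simp [hc]; ring)
  have e₁ := h₁.coeff_eq_zero ![1, 0, 0] (c₀ := c 0 5) (c₁ := c 1 4) (c₂ := c 2 3) (c₃ := c 3 2)
    (c₄ := c 4 1) (c₅ := c 5 0) (fun t => by simp [hc])
  have e₁' := h₁.coeff_eq_zero ![0, 0, 1] (c₀ := c 0 5) (c₁ := c 0 4) (c₂ := c 0 3) (c₃ := c 0 2)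
    (c₄ := c 0 1) (c₅ := c 0 0) (fun t => by simp [hc]; ring)
  have e₂ := h₂.coeff_eq_zero ![1, 0, 0] (c₀ := c 0 0) (c₁ := c 1 0) (c₂ := c 2 0) (c₃ := c 3 0)
    (c₄ := c 4 0) (c₅ := c 5 0) (fun t => by simp [hc])
  have e₂' := h₂.coeff_eq_zero ![0, 1, 0] (c₀ := c 0 0) (c₁ := c 0 1) (c₂ := c 0 2) (c₃ := c 0 3)
    (c₄ := c 0 4) (c₅ := c 0 5) (fun t => by simp [hc])
  simp only [e₀, e₀', e₁, e₁', e₂, e₂', zero_mul, add_zero, zero_add] at hc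
  have hcx : ∀ x, F x = F ![x 0, x 1, x 2] := fun x => by
    congr 1; ext i; fin_cases i <;> rfl
  refine ⟨_, (((((((((((IsForm.monomial (c 0 2) 3 1 0).add (.monomial (c 0 3) 3 0 1)).add
    (.monomial (c 1 1) 2 2 0)).add (.monomial (c 1 2) 2 1 1)).add (.monomial (c 1 3) 2 0 2)).add
    (.monomial (c 2 0) 1 3 0)).add (.monomial (c 2 1) 1 2 1)).add (.monomial (c 2 2) 1 1 2)).add
    (.monomial (c 2 3) 1 0 3)).add (.monomial (c 3 0) 0 3 1)).add
    (.monomial (c 3 1) 0 2 2)).add (.monomial (c 3 2) 0 1 3), by simp, by simp, by simp,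
    fun x => ?_, fun x => ?_⟩
  · rw [cremona, hc]
    ring
  · rw [hcx, hc]
    simp [cremona]
    ring

theorem IsDoublePoint.cremona {F G : (Fin 3 → ℂ) → ℂ} {n : ℕ} (hF : IsForm n F)
    (hFG : ∀ x, F (cremona x) = (x 0 * x 1 * x 2) ^ 2 * G x) {u : Fin 3 → ℂ}
    (hu : u 0 * u 1 * u 2 ≠ 0) (h : IsDoublePoint F u) : IsDoublePoint G (_root_.cremona u) := by
  have hy : IsDoublePoint F (_root_.cremona (_root_.cremona u)) := by
    rw [cremona_cremona]
    exact h.smul hF hu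
  set y := _root_.cremona u with hy'
  have hP : (y 0 * y 1 * y 2) ^ 2 ≠ 0 := by
    have : y 0 * y 1 * y 2 = (u 0 * u 1 * u 2) ^ 2 := by
      simp [hy', _root_.cremona]
      ring
    rw [this]
    exact pow_ne_zero _ (pow_ne_zero _ hu)
  have hG : ∀ x : Fin 3 → ℂ, (x 0 * x 1 * x 2) ^ 2 ≠ 0 →
      G x = ((x 0 * x 1 * x 2) ^ 2)⁻¹ * F (_root_.cremona x) := fun x hx => by
    rw [hFG, inv_mul_cancel_left₀ hx]
  refine ⟨by rw [hG y hP, hy.1, mul_zero], ?_⟩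
  have hF' := hy.2.comp y (differentiable_cremona y).hasFDerivAt
  have hd : DifferentiableAt ℂ (fun x : Fin 3 → ℂ => ((x 0 * x 1 * x 2) ^ 2)⁻¹) y :=
    DifferentiableAt.inv (by fun_prop) hP
  have hcont : Continuous fun x : Fin 3 → ℂ => (x 0 * x 1 * x 2) ^ 2 := by fun_prop
  refine ((hd.hasFDerivAt.mul hF').congr_of_eventuallyEq ?_).congr_fderiv ?_
  · filter_upwards [hcont.continuousAt.eventually_ne hP] with x hx
    simp [hG x hx]
  · ext w
    simp [hy.1]

/-- No three of the points lie on a line and no six on a conic. -/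
def GeneralPosition (p : Fin 7 → Fin 3 → ℂ) : Prop :=
  (∀ L, IsForm 1 L → ∀ i j k, i ≠ j → i ≠ k → j ≠ k →
    L (p i) = 0 → L (p j) = 0 → L (p k) = 0 → L = 0) ∧
  ∀ Q, IsForm 2 Q → ∀ m, (∀ i, i ≠ m → Q (p i) = 0) → Q = 0

theorem isForm_one_linear (a b c : ℂ) : IsForm 1 (fun x => a * x 0 + b * x 1 + c * x 2) := by
  simpa using ((IsForm.monomial a 1 0 0).add (.monomial b 0 1 0)).add (.monomial c 0 0 1)

theorem isForm_two_quadratic (a b c d e f : ℂ) : IsForm 2 (fun x => a * x 0 ^ 2 + b * x 1 ^ 2 +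
    c * x 2 ^ 2 + d * (x 1 * x 2) + e * (x 0 * x 2) + f * (x 0 * x 1)) := by
  simpa [mul_assoc] using (((((IsForm.monomial a 2 0 0).add (.monomial b 0 2 0)).add
    (.monomial c 0 0 2)).add (.monomial d 0 1 1)).add (.monomial e 1 0 1)).add
    (.monomial f 1 1 0)

theorem exists_linear_of_det_eq_zero {p : Fin 3 → Fin 3 → ℂ} (h : (Matrix.of p).det = 0) :
    ∃ a b c : ℂ, ¬ (a = 0 ∧ b = 0 ∧ c = 0) ∧
      ∀ i, a * p i 0 + b * p i 1 + c * p i 2 = 0 := by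
  obtain ⟨w, hw, hz⟩ := Matrix.exists_mulVec_eq_zero_iff.2 h
  refine ⟨w 0, w 1, w 2, fun h => hw ?_, fun i => ?_⟩
  · ext i
    fin_cases i <;> simp [h]
  · have := congrFun hz i
    simp only [Matrix.mulVec, dotProduct, Fin.sum_univ_three, Matrix.of_apply,
      Pi.zero_apply] at this
    linear_combination this

namespace GeneralPosition

variable {p : Fin 7 → Fin 3 → ℂ}

theorem vecMul (hp : GeneralPosition p) {N : Matrix (Fin 3) (Fin 3) ℂ} (hN : IsUnit N.det) :
    GeneralPosition fun i => Matrix.vecMul (p i) N := by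
  have h : ∀ L : (Fin 3 → ℂ) → ℂ, (fun x => L (Matrix.vecMul x N)) = 0 → L = 0 := fun L hL => by
    ext x
    have := congrFun hL (Matrix.vecMul x N⁻¹)
    simpa [Matrix.vecMul_vecMul, Matrix.nonsing_inv_mul _ hN] using this
  exact ⟨fun L hL i j k hij hik hjk h₁ h₂ h₃ =>
      h L (hp.1 _ (hL.comp_vecMul N) i j k hij hik hjk h₁ h₂ h₃),
    fun Q hQ m hm => h Q (hp.2 _ (hQ.comp_vecMul N) m hm)⟩

theorem det_ne_zero (hp : GeneralPosition p) {i j k : Fin 7} (hij : i ≠ j) (hik : i ≠ k)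
    (hjk : j ≠ k) : (Matrix.of ![p i, p j, p k]).det ≠ 0 := by
  intro h
  obtain ⟨a, b, c, hne, hz⟩ := exists_linear_of_det_eq_zero h
  have h0 := hp.1 _ (isForm_one_linear a b c) i j k hij hik hjk (hz 0) (hz 1) (hz 2)
  exact hne ⟨by simpa using congrFun h0 ![1, 0, 0], by simpa using congrFun h0 ![0, 1, 0],
    by simpa using congrFun h0 ![0, 0, 1]⟩

theorem coord_mul_ne_zero (hp : GeneralPosition p) (h₀ : p 0 = ![1, 0, 0]) (h₁ : p 1 = ![0, 1, 0])
    (h₂ : p 2 = ![0, 0, 1]) (i : Fin 4) :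
    p (i.natAdd 3) 0 * p (i.natAdd 3) 1 * p (i.natAdd 3) 2 ≠ 0 := by
  have ne : ∀ k : Fin 3, Fin.castAdd 4 k ≠ i.natAdd 3 := fun k => by
    simp [Fin.ext_iff]; omega
  have d₀ := hp.det_ne_zero (i := 1) (j := 2) (by decide) (ne 1) (ne 2)
  have d₁ := hp.det_ne_zero (i := 0) (j := 2) (by decide) (ne 0) (ne 2)
  have d₂ := hp.det_ne_zero (i := 0) (j := 1) (by decide) (ne 0) (ne 1)
  rw [h₁, h₂] at d₀
  rw [h₀, h₂] at d₁
  rw [h₀, h₁] at d₂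
  refine mul_ne_zero (mul_ne_zero ?_ ?_) ?_
  · simpa [Matrix.det_fin_three] using d₀
  · simpa [Matrix.det_fin_three] using d₁
  · simpa [Matrix.det_fin_three] using d₂

theorem cremona_det_ne_zero (hp : GeneralPosition p) (h₀ : p 0 = ![1, 0, 0]) (h₁ : p 1 = ![0, 1, 0])
    (h₂ : p 2 = ![0, 0, 1])
    (i j k : Fin 4) (hij : i ≠ j) (hik : i ≠ k) (hjk : j ≠ k) :
    (Matrix.of ![cremona (p (i.natAdd 3)), cremona (p (j.natAdd 3)),
      cremona (p (k.natAdd 3))]).det ≠ 0 := by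
  intro h
  obtain ⟨a, b, c, hne, hz⟩ := exists_linear_of_det_eq_zero h
  obtain ⟨m, hm⟩ : ∃ m : Fin 4, ∀ l, l ≠ m → l = i ∨ l = j ∨ l = k := by
    clear hz h
    revert i j k; decide
  have h0 := hp.2 _ (isForm_two_quadratic 0 0 0 a b c) (m.natAdd 3) fun l hl => by
    refine Fin.addCases (m := 3) (n := 4) (fun l _ => ?_) (fun l hl => ?_) l hl
    · fin_cases l
      · simp [h₀]
      · simp [h₁]
      · simp [h₂]
    · have := hz 0
      have := hz 1
      have := hz 2
      rcases hm l (fun h => hl (by rw [h])) with rfl | rfl | rfl <;> simp_all [cremona]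
  exact hne ⟨by simpa using congrFun h0 ![0, 1, 1], by simpa using congrFun h0 ![1, 0, 1],
    by simpa using congrFun h0 ![1, 1, 0]⟩

end GeneralPosition

/-- A conic through two coordinate points and the transformed points comes from a conic through
six of the original points. -/
theorem GeneralPosition.cremona_conic_eq_zero {p : Fin 7 → Fin 3 → ℂ} (hp : GeneralPosition p)
    (h₀ : p 0 = ![1, 0, 0]) (h₁ : p 1 = ![0, 1, 0]) (h₂ : p 2 = ![0, 0, 1])
    {Q : (Fin 3 → ℂ) → ℂ} (hQ : IsForm 2 Q) (hz : ∀ i : Fin 4, Q (cremona (p (i.natAdd 3))) = 0)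
    (m : Fin 3) (hm : ∀ i : Fin 3, i ≠ m → Q (p (i.castAdd 4)) = 0) : Q = 0 := by
  obtain ⟨c, hc⟩ := hQ.exists_coeff
  simp only [Finset.sum_range_succ, Finset.sum_range_zero, Nat.reduceAdd, Nat.reduceSub,
    zero_add, pow_zero, mul_one, pow_one] at hc
  have hu := hp.coord_mul_ne_zero h₀ h₁ h₂
  have hQc : (∀ i j, i + j ≤ 2 → c i j = 0) → Q = 0 := fun h => by
    ext x
    have hx : x = ![x 0, x 1, x 2] := by ext i; fin_cases i <;> rfl
    rw [hx, hc]
    simp [h]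
  have hsix : ∀ {a b d e f g : ℂ},
      (∀ i : Fin 4, a * p (i.natAdd 3) 0 ^ 2 + b * p (i.natAdd 3) 1 ^ 2 + d * p (i.natAdd 3) 2 ^ 2 +
        e * (p (i.natAdd 3) 1 * p (i.natAdd 3) 2) + f * (p (i.natAdd 3) 0 * p (i.natAdd 3) 2) +
        g * (p (i.natAdd 3) 0 * p (i.natAdd 3) 1) = 0) →
      (∀ i, i ≠ m → ![a, b, d] i = 0) →
      a = 0 ∧ b = 0 ∧ d = 0 ∧ e = 0 ∧ f = 0 ∧ g = 0 := by
    intro a b d e f g hi hd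
    have h0 := hp.2 _ (isForm_two_quadratic a b d e f g) (m.castAdd 4) fun l hl => by
      refine Fin.addCases (m := 3) (n := 4) (fun l hl => ?_) (fun l _ => hi l) l hl
      have := hd l fun h => hl (by rw [h])
      fin_cases l
      · simpa [h₀] using this
      · simpa [h₁] using this
      · simpa [h₂] using this
    have ha : a = 0 := by simpa using congrFun h0 ![1, 0, 0]
    have hb : b = 0 := by simpa using congrFun h0 ![0, 1, 0]
    have hd' : d = 0 := by simpa using congrFun h0 ![0, 0, 1]
    exact ⟨ha, hb, hd', by simpa [hb, hd'] using congrFun h0 ![0, 1, 1],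
      by simpa [ha, hd'] using congrFun h0 ![1, 0, 1],
      by simpa [ha, hb] using congrFun h0 ![1, 1, 0]⟩
  have hx : m ≠ 0 → c 2 0 = 0 := fun h => by
    have : Q (p 0) = 0 := hm 0 h.symm
    simpa [h₀, hc] using this
  have hy : m ≠ 1 → c 0 2 = 0 := fun h => by
    have : Q (p 1) = 0 := hm 1 h.symm
    simpa [h₁, hc] using this
  have hw : m ≠ 2 → c 0 0 = 0 := fun h => by
    have : Q (p 2) = 0 := hm 2 h.symm
    simpa [h₂, hc] using this
  apply hQc
  simp only [cremona, hc] at hz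
  have hall : c 0 0 = 0 ∧ c 0 1 = 0 ∧ c 0 2 = 0 ∧ c 1 0 = 0 ∧ c 1 1 = 0 ∧ c 2 0 = 0 := by
    have hm₃ : m = 0 ∨ m = 1 ∨ m = 2 := by
      clear * -
      revert m
      decide
    rcases hm₃ with rfl | rfl | rfl
    · have hy := hy (by decide)
      have hw := hw (by decide)
      obtain ⟨h₁, -, -, h₂, h₃, h₄⟩ := hsix (a := c 0 1) (b := 0) (d := 0) (e := c 2 0)
        (f := c 1 1) (g := c 1 0)
        (fun i => eq_zero_of_ne_zero_of_mul_left_eq_zero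
          (x := p (i.natAdd 3) 1 * p (i.natAdd 3) 2)
          (fun h => hu i (by rw [mul_assoc, h, mul_zero]))
          (by have := hz i; rw [hy, hw] at this; linear_combination this))
        (fun i hi => by
          fin_cases i
          · exact absurd rfl hi
          · rfl
          · rfl)
      exact ⟨hw, h₁, hy, h₄, h₃, h₂⟩
    · have hx := hx (by decide)
      have hw := hw (by decide)
      obtain ⟨-, h₁, -, h₂, h₃, h₄⟩ := hsix (a := 0) (b := c 1 0) (d := 0) (e := c 1 1)
        (f := c 0 2) (g := c 0 1)
        (fun i => eq_zero_of_ne_zero_of_mul_left_eq_zero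
          (x := p (i.natAdd 3) 0 * p (i.natAdd 3) 2)
          (fun h => hu i (by rw [mul_right_comm, h, zero_mul]))
          (by have := hz i; rw [hx, hw] at this; linear_combination this))
        (fun i hi => by
          fin_cases i
          · rfl
          · exact absurd rfl hi
          · rfl)
      exact ⟨hw, h₄, h₃, h₁, h₂, hx⟩
    · have hx := hx (by decide)
      have hy := hy (by decide)
      obtain ⟨-, -, h₁, h₂, h₃, h₄⟩ := hsix (a := 0) (b := 0) (d := c 1 1) (e := c 1 0)
        (f := c 0 1) (g := c 0 0)
        (fun i => eq_zero_of_ne_zero_of_mul_left_eq_zero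
          (x := p (i.natAdd 3) 0 * p (i.natAdd 3) 1)
          (fun h => hu i (by rw [h, zero_mul]))
          (by have := hz i; rw [hx, hy] at this; linear_combination this))
        (fun i hi => by
          fin_cases i
          · rfl
          · rfl
          · exact absurd rfl hi)
      exact ⟨h₄, h₃, hy, h₂, h₁, hx⟩
  obtain ⟨k₁, k₂, k₃, k₄, k₅, k₆⟩ := hall
  intro i j hij
  have : i ≤ 2 := by omega
  have : j ≤ 2 := by omega
  interval_cases i <;> interval_cases j <;> first | assumption | omega

theorem IsForm.eq_zero_of_coord_mul_eq_zero {n : ℕ} {F : (Fin 3 → ℂ) → ℂ} (hF : IsForm n F)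
    (h : ∀ x, x 0 * x 1 * x 2 * F x = 0) : F = 0 := by
  obtain ⟨f, -, rfl⟩ := hF
  have : MvPolynomial.X 0 * MvPolynomial.X 1 * MvPolynomial.X 2 * f = 0 :=
    MvPolynomial.funext fun x => by simpa using h x
  have hf : f = 0 := by simpa [MvPolynomial.X_ne_zero] using this
  ext x
  simp [hf]

/-- A quintic with double points at seven points in general position, the first three of which are
the coordinate points, vanishes. -/
theorem GeneralPosition.quintic_eq_zero {p : Fin 7 → Fin 3 → ℂ} (hp : GeneralPosition p)
    (h₀ : p 0 = ![1, 0, 0]) (h₁ : p 1 = ![0, 1, 0]) (h₂ : p 2 = ![0, 0, 1])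
    {F : (Fin 3 → ℂ) → ℂ} (hF : IsForm 5 F) (hs : ∀ i, IsDoublePoint F (p i)) : F = 0 := by
  obtain ⟨G, hG, hG₀, hG₁, hG₂, hFG, hGF⟩ := exists_quartic_cremona hF
    (h₀ ▸ hs 0) (h₁ ▸ hs 1) (h₂ ▸ hs 2)
  by_contra hF₀
  have hGne : G ≠ 0 := by
    rintro rfl
    exact hF₀ (hF.eq_zero_of_coord_mul_eq_zero fun x => (hGF x).symm)
  obtain ⟨Q, hQ, hQne, hQz, m, hm⟩ := exists_conic_of_quartic hG hGne
    (fun i => cremona (p (i.natAdd 3))) (hp.cremona_det_ne_zero h₀ h₁ h₂)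
    (fun i => .cremona hF hFG (hp.coord_mul_ne_zero h₀ h₁ h₂ i) (hs _))
    (fun i => p (i.castAdd 4)) (fun i => by
      fin_cases i
      · simpa [h₀] using hG₀
      · simpa [h₁] using hG₁
      · simpa [h₂] using hG₂)
  exact hQne (hp.cremona_conic_eq_zero h₀ h₁ h₂ hQ hQz m hm)

/-- No plane curve of degree 5 can have 7 singular points in general position
(no 3 on a line, no 6 on a conic, no 10 on a cubic). -/
theorem stmt_12 (f : MvPolynomial (Fin 3) ℂ)
    (hf0 : f ≠ 0) (hf : f.IsHomogeneous 5)
    (v : Fin 7 → (Fin 3 → ℂ)) (hv0 : ∀ i, v i ≠ 0)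
    (hdist : ∀ i j, i ≠ j → ∀ c : ℂ, v i ≠ c • v j)
    (hline : ∀ g : MvPolynomial (Fin 3) ℂ, g ≠ 0 → g.IsHomogeneous 1 →
      ({i : Fin 7 | MvPolynomial.eval (v i) g = 0}).ncard ≤ 2)
    (hconic : ∀ q : MvPolynomial (Fin 3) ℂ, q ≠ 0 → q.IsHomogeneous 2 →
      ({i : Fin 7 | MvPolynomial.eval (v i) q = 0}).ncard ≤ 5)
    (hcubic : ∀ c : MvPolynomial (Fin 3) ℂ, c ≠ 0 → c.IsHomogeneous 3 →
      ({i : Fin 7 | MvPolynomial.eval (v i) c = 0}).ncard ≤ 9)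
    (hsing : ∀ i, SingularAt f (v i)) :
    False := by
  have hv : GeneralPosition v := by
    constructor
    · rintro _ ⟨g, hg, rfl⟩ i j k hij hik hjk hi hj hk
      by_contra hne
      have hsub : (({i, j, k} : Finset (Fin 7)) : Set (Fin 7)) ⊆
          {i | MvPolynomial.eval (v i) g = 0} := by
        intro l hl
        simp only [Finset.coe_insert, Finset.coe_singleton, Set.mem_insert_iff,
          Set.mem_singleton_iff] at hl
        rcases hl with rfl | rfl | rfl <;> assumption
      have hle := (Set.ncard_le_ncard hsub).trans
        (hline g (fun h => hne (by ext; simp [h])) hg)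
      rw [Set.ncard_coe_finset, Finset.card_eq_three.2 ⟨i, j, k, hij, hik, hjk, rfl⟩] at hle
      omega
    · rintro _ ⟨q, hq, rfl⟩ m hm
      by_contra hne
      have hsub : (({m}ᶜ : Finset (Fin 7)) : Set (Fin 7)) ⊆
          {i | MvPolynomial.eval (v i) q = 0} := by
        intro l hl
        exact hm l (by simpa using hl)
      have hle := (Set.ncard_le_ncard hsub).trans
        (hconic q (fun h => hne (by ext; simp [h])) hq)
      rw [Set.ncard_coe_finset, Finset.card_compl] at hle
      simp at hle
  let N : Matrix (Fin 3) (Fin 3) ℂ := .of ![v 0, v 1, v 2]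
  have hN : IsUnit N.det :=
    isUnit_iff_ne_zero.2 (hv.det_ne_zero (by decide) (by decide) (by decide))
  have hNN : ∀ x, Matrix.vecMul (Matrix.vecMul x N) N⁻¹ = x := fun x => by
    rw [Matrix.vecMul_vecMul, Matrix.mul_nonsing_inv _ hN, Matrix.vecMul_one]
  have hNN' : ∀ x, Matrix.vecMul (Matrix.vecMul x N⁻¹) N = x := fun x => by
    rw [Matrix.vecMul_vecMul, Matrix.nonsing_inv_mul _ hN, Matrix.vecMul_one]
  have hF : IsForm 5 fun x => MvPolynomial.eval x f := ⟨f, hf, rfl⟩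
  have hzero := (hv.vecMul (Matrix.isUnit_nonsing_inv_det N hN)).quintic_eq_zero
    (by rw [← hNN ![1, 0, 0]]; simp [N]) (by rw [← hNN ![0, 1, 0]]; simp [N])
    (by rw [← hNN ![0, 0, 1]]; simp [N]) (hF.comp_vecMul N)
    (fun i => .comp_vecMul (by rw [hNN']; exact .of_singularAt hf (by decide) (hsing i)))
  refine hf0 (MvPolynomial.funext fun x => ?_)
  simpa [hNN'] using congrFun hzero (Matrix.vecMul x N⁻¹)
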